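/- arXiv:2109.12432 — 2 statements merged into one kernel-verified Lean document; each statement's English description precedes it below -/
import Mathlib

section
/- For every m ≥ 2, the transfer digraph D*_m is disconnected — there exist vertices p, q ∈ V(D*_m) not joined by any walk in the symmetrization of the arc relation — and each of its components is strongly connected: for all p, q ∈ V(D*_m), if q is reachable from p by a directed walk then p is reachable from q by a directed walk. -/
/-- The six alpha-letters, recording which two of the four directions are used
at a grid vertex by a 2-factor: `a` = down&right, `b` = up&down, `c` = up&right,
`d` = down&left, `e` = left&right, `f` = up&left. -/
inductive Alpha : Type
  | a | b | c | d | e | f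
  deriving DecidableEq

/-- The letter has a right edge iff it lies in `{a, c, e}`. -/
def Alpha.right : Alpha → Bool
  | .a => true
  | .c => true
  | .e => true
  | _ => false

/-- The letter has a left edge iff it lies in `{d, e, f}`. -/
def Alpha.left : Alpha → Bool
  | .d => true
  | .e => true
  | .f => true
  | _ => false

/-- The letter has a down edge iff it lies in `{a, b, d}`. -/
def Alpha.down : Alpha → Bool
  | .a => true
  | .b => true
  | .d => true
  | _ => false

/-- The letter has an up edge iff it lies in `{b, c, f}`. -/
def Alpha.up : Alpha → Bool
  | .b => true
  | .c => true
  | .f => true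
  | _ => false

/-- Membership in the vertex set `V(D_m)` of the digraph `D_m`: consecutive letters are
compatible (`w i` has a down edge iff `w (i+1)` has an up edge), the first letter has no
up edge, and the last letter has no down edge. -/
def InVD {m : ℕ} (w : Fin m → Alpha) : Prop :=
  (∀ i j : Fin m, (j : ℕ) = (i : ℕ) + 1 → (w i).down = (w j).up) ∧
  (∀ i : Fin m, (i : ℕ) = 0 → (w i).up = false) ∧
  (∀ i : Fin m, (i : ℕ) = m - 1 → (w i).down = false)

/-- The arc relation of the digraph `D_m`: `v → u` iff both are vertices of `D_m` and for
every `i`, `v i` has a right edge iff `u i` has a left edge. -/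
def DArc {m : ℕ} (v u : Fin m → Alpha) : Prop :=
  InVD v ∧ InVD u ∧ ∀ i, (v i).right = (u i).left

/-- The outlet word of an alpha-word: `o(w) i = true` iff `w i` has a right edge. -/
def outlet {m : ℕ} (w : Fin m → Alpha) : Fin m → Bool :=
  fun i => (w i).right

/-- Membership in the vertex set `V(D*_m)` of the transfer digraph `D*_m`: the binary
words realized as outlet words of vertices of `D_m`. -/
def InVDStar {m : ℕ} (p : Fin m → Bool) : Prop :=
  ∃ w : Fin m → Alpha, InVD w ∧ outlet w = p

/-- The arc relation of the transfer digraph `D*_m`: `p → q` iff there are vertices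
`v, u` of `D_m` with outlet words `p, q` and an arc `v → u` in `D_m`. -/
def DStarArc {m : ℕ} (p q : Fin m → Bool) : Prop :=
  ∃ v u : Fin m → Alpha, outlet v = p ∧ outlet u = q ∧ DArc v u

/-- Reflection of a letter in a vertical axis. -/
def Alpha.mirror : Alpha → Alpha
  | .a => .d
  | .b => .b
  | .c => .f
  | .d => .a
  | .e => .e
  | .f => .c

@[simp] theorem Alpha.mirror_left (x : Alpha) : x.mirror.left = x.right := by cases x <;> rfl

@[simp] theorem Alpha.mirror_right (x : Alpha) : x.mirror.right = x.left := by cases x <;> rfl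

@[simp] theorem Alpha.mirror_up (x : Alpha) : x.mirror.up = x.up := by cases x <;> rfl

@[simp] theorem Alpha.mirror_down (x : Alpha) : x.mirror.down = x.down := by cases x <;> rfl

theorem InVD.mirror {m : ℕ} {w : Fin m → Alpha} (h : InVD w) :
    InVD fun i => (w i).mirror := by
  simpa [InVD] using h

theorem DStarArc.symm {m : ℕ} {p q : Fin m → Bool} (h : DStarArc p q) : DStarArc q p := by
  obtain ⟨v, u, rfl, rfl, -, hu, hvu⟩ := h
  refine ⟨u, fun i => (u i).mirror, rfl, ?_, hu, hu.mirror, fun i => by simp⟩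
  funext i
  simp [outlet, hvu i]

/-- The alternating count of the positions where a binary word is `false`. -/
def altFalseCount {m : ℕ} (p : Fin m → Bool) : ℤ :=
  ∑ i : Fin m, (-1) ^ (i : ℕ) * (!p i).toInt

/-- Each vertex of `D_m` has alternating sum of vertical degrees equal to zero. -/
theorem InVD.sum_vertical_eq_zero {m : ℕ} {w : Fin m → Alpha} (h : InVD w) :
    ∑ i : Fin m, (-1 : ℤ) ^ (i : ℕ) * ((w i).up.toInt + (w i).down.toInt) = 0 := by
  obtain ⟨hadj, hfirst, hlast⟩ := h
  let U : ℕ → ℤ := fun i => if hi : i < m then (w ⟨i, hi⟩).up.toInt else 0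
  have telescope (n : ℕ) :
      ∑ i ∈ Finset.range n, (-1 : ℤ) ^ i * (U i + U (i + 1)) = U 0 - (-1) ^ n * U n := by
    induction n with
    | zero => simp
    | succ n ih => rw [Finset.sum_range_succ, ih]; ring
  have hU0 : U 0 = 0 := by
    by_cases h0 : 0 < m
    · simp [U, h0, hfirst ⟨0, h0⟩ rfl]
    · simp [U, h0]
  have hUm : U m = 0 := by simp [U]
  calc
    _ = ∑ i : Fin m, (-1 : ℤ) ^ (i : ℕ) * (U i + U (i + 1)) := by
      refine Finset.sum_congr rfl fun i _ => ?_
      congr 2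
      · simp [U]
      · by_cases hi : (i : ℕ) + 1 < m
        · simp [U, hi, hadj i ⟨i + 1, hi⟩ rfl]
        · simp [U, hi, hlast i (by omega)]
    _ = 0 := by
      rw [Fin.sum_univ_eq_sum_range (fun i => (-1 : ℤ) ^ i * (U i + U (i + 1))), telescope,
        hU0, hUm]
      simp

theorem DStarArc.altFalseCount_eq_neg {m : ℕ} {p q : Fin m → Bool} (h : DStarArc p q) :
    altFalseCount q = -altFalseCount p := by
  obtain ⟨v, u, rfl, rfl, -, hu, hvu⟩ := h
  rw [eq_neg_iff_add_eq_zero, altFalseCount, altFalseCount, ← Finset.sum_add_distrib,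
    ← hu.sum_vertical_eq_zero]
  refine Finset.sum_congr rfl fun i _ => ?_
  rw [← mul_add]
  congr 1
  simp only [outlet, hvu i]
  cases u i <;> rfl

theorem altFalseCount_eq_zero_of_reflTransGen {m : ℕ} {p q : Fin m → Bool}
    (h : Relation.ReflTransGen (fun x y => DStarArc x y ∨ DStarArc y x) p q)
    (hp : altFalseCount p = 0) : altFalseCount q = 0 := by
  induction h with
  | refl => exact hp
  | tail _ hbc ih =>
    have hbc := (hbc.elim id DStarArc.symm).altFalseCount_eq_neg
    rw [hbc, ih, neg_zero]

theorem inVDStar_true (m : ℕ) : InVDStar fun _ : Fin m => true :=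
  ⟨fun _ => .e, by simp [InVD, Alpha.up, Alpha.down], rfl⟩

theorem inVDStar_ne_one {m : ℕ} (hm : 2 ≤ m) :
    InVDStar fun i : Fin m => decide ((i : ℕ) ≠ 1) := by
  refine ⟨fun i => if (i : ℕ) = 0 then .a else if (i : ℕ) = 1 then .f else .e,
    ⟨fun i j hij => ?_, fun i hi => ?_, fun i hi => ?_⟩, ?_⟩
  · dsimp only
    split_ifs <;> first | rfl | omega
  · simp [hi, Alpha.up]
  · dsimp only
    split_ifs <;> first | rfl | omega
  · funext i
    dsimp only [outlet]
    split_ifs with h0 h1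
    all_goals simp [*, Alpha.right]

theorem altFalseCount_ne_one {m : ℕ} (hm : 2 ≤ m) :
    altFalseCount (fun i : Fin m => decide ((i : ℕ) ≠ 1)) = -1 := by
  rw [altFalseCount, Finset.sum_eq_single_of_mem ⟨1, hm⟩ (Finset.mem_univ _)]
  · simp
  · intro i _ hi
    have : (i : ℕ) ≠ 1 := fun h => hi (Fin.ext h)
    simp [this]

/-- For `m ≥ 2`, the transfer digraph `D*_m` is disconnected, and each of its components
is strongly connected. -/
theorem DStar_disconnected_strong_components (m : ℕ) (hm : 2 ≤ m) :
    (∃ p q : Fin m → Bool, InVDStar p ∧ InVDStar q ∧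
      ¬ Relation.ReflTransGen (fun x y => DStarArc x y ∨ DStarArc y x) p q) ∧
    (∀ p q : Fin m → Bool, InVDStar p → InVDStar q →
      Relation.ReflTransGen DStarArc p q → Relation.ReflTransGen DStarArc q p) := by
  refine ⟨⟨fun _ => true, fun i => decide ((i : ℕ) ≠ 1), inVDStar_true m, inVDStar_ne_one hm,
    fun h => ?_⟩, fun p q _ _ h => ?_⟩
  · have := altFalseCount_eq_zero_of_reflTransGen h (by simp [altFalseCount])
    rw [altFalseCount_ne_one hm] at this
    exact absurd this (by decide)
  · exact (@Relation.ReflTransGen.stdSymm _ _ ⟨fun _ _ => DStarArc.symm⟩).symm _ _ h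
end

section
/- For every m ≥ 2, the all-true word 1^m and the all-false word 0^m are mutually reachable in the transfer digraph D*_m if and only if m is even. (That is, the component A*_m of D*_m containing the unique looped vertex 1^m coincides with the component R*_m containing 0^m iff m is even.) -/
/-- The alternating sum of a binary word, its letters read as `0` and `1`. -/
def altSum {m : ℕ} (p : Fin m → Bool) : ℤ :=
  ∑ i : Fin m, (-1) ^ (i : ℕ) * ((p i).toNat : ℤ)

/-- Every letter uses exactly two of the four directions. -/
theorem Alpha.left_add_right (x : Alpha) :
    (x.left.toNat : ℤ) + x.right.toNat = 2 - (x.up.toNat + x.down.toNat) := by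
  cases x <;> rfl

theorem sum_range_alternating_add_succ (x : ℕ → ℤ) (n : ℕ) :
    ∑ i ∈ Finset.range n, (-1) ^ i * (x i + x (i + 1)) = x 0 - (-1) ^ n * x n := by
  induction n with
  | zero => simp
  | succ n ih => rw [Finset.sum_range_succ, ih]; ring

/-- The vertical edges of a vertex of `D_m` cancel in the alternating sum. -/
theorem InVD.sum_up_add_down {m : ℕ} {w : Fin m → Alpha} (hw : InVD w) :
    ∑ i : Fin m, (-1) ^ (i : ℕ) * (((w i).up.toNat : ℤ) + (w i).down.toNat) = 0 := by
  obtain ⟨hstep, hfirst, hlast⟩ := hw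
  let x : ℕ → ℤ := fun k => if h : k < m then ((w ⟨k, h⟩).up.toNat : ℤ) else 0
  have hx : ∀ i : Fin m, ((w i).up.toNat : ℤ) + (w i).down.toNat = x i + x (i + 1) := by
    intro i
    have hup : x i = (w i).up.toNat := by simp [x]
    have hdown : x (i + 1) = (w i).down.toNat := by
      by_cases h : (i : ℕ) + 1 < m
      · simp [x, h, hstep i ⟨i + 1, h⟩ rfl]
      · simp [x, h, hlast i (by omega)]
    rw [hup, hdown]
  simp only [hx]
  rw [Fin.sum_univ_eq_sum_range (fun i => (-1) ^ i * (x i + x (i + 1))),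
    sum_range_alternating_add_succ]
  have h0 : x 0 = 0 := by
    by_cases h : 0 < m
    · simp [x, h, hfirst ⟨0, h⟩ rfl]
    · simp [x, h]
  have hm : x m = 0 := by simp [x]
  simp [h0, hm]

theorem sum_alternating_of_odd {m : ℕ} (hm : Odd m) : ∑ i : Fin m, (-1 : ℤ) ^ (i : ℕ) = 1 := by
  rw [Fin.sum_univ_eq_sum_range (fun i => (-1 : ℤ) ^ i), neg_one_geom_sum,
    if_neg (Nat.not_even_iff_odd.mpr hm)]

theorem altSum_allTrue {m : ℕ} (hm : Odd m) : altSum (fun _ : Fin m => true) = 1 := by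
  simpa [altSum] using sum_alternating_of_odd hm

theorem DStarArc.altSum_add {m : ℕ} (hm : Odd m) {p q : Fin m → Bool} (h : DStarArc p q) :
    altSum p + altSum q = 2 := by
  obtain ⟨v, u, rfl, rfl, -, hu, hvu⟩ := h
  simp only [altSum, outlet, hvu, ← Finset.sum_add_distrib, ← mul_add, Alpha.left_add_right]
  simp only [mul_sub, Finset.sum_sub_distrib, hu.sum_up_add_down, ← Finset.sum_mul,
    sum_alternating_of_odd hm]
  norm_num

theorem altSum_eq_one_of_reachable {m : ℕ} (hm : Odd m) {q : Fin m → Bool}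
    (h : Relation.ReflTransGen DStarArc (fun _ => true) q) : altSum q = 1 := by
  induction h with
  | refl => exact altSum_allTrue hm
  | tail _ harc ih =>
    have := harc.altSum_add hm
    omega

theorem inVD_const_e (m : ℕ) : InVD (fun _ : Fin m => Alpha.e) := by
  simp [InVD, Alpha.up, Alpha.down]

/-- For even `m`, alternating a letter using `down` but not `up` with a letter using `up` but not
`down` gives a vertex of `D_m`. -/
theorem inVD_alternating {m : ℕ} (hm : Even m) {x y : Alpha} (hxu : x.up = false)
    (hxd : x.down = true) (hyu : y.up = true) (hyd : y.down = false) :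
    InVD (fun i : Fin m => if Even (i : ℕ) then x else y) := by
  refine ⟨fun i j hij => ?_, fun i hi => ?_, fun i hi => ?_⟩
  · by_cases h : Even (i : ℕ) <;> simp [hij, Nat.even_add_one, h, hxu, hxd, hyu, hyd]
  · simp [hi, hxu]
  · have h : ¬ Even (i : ℕ) := by
      have := i.isLt
      rw [Nat.even_iff] at hm ⊢
      omega
    simp [h, hyd]

theorem dStarArc_allTrue_allFalse {m : ℕ} (hm : Even m) :
    DStarArc (fun _ : Fin m => true) (fun _ => false) := by
  refine ⟨fun _ => .e, fun i => if Even (i : ℕ) then .d else .f, rfl, ?_, inVD_const_e m,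
    inVD_alternating hm rfl rfl rfl rfl, fun i => ?_⟩
  · funext i
    simp only [outlet]
    split_ifs <;> rfl
  · dsimp only
    split_ifs <;> rfl

theorem dStarArc_allFalse_allTrue {m : ℕ} (hm : Even m) :
    DStarArc (fun _ : Fin m => false) (fun _ => true) := by
  refine ⟨fun i => if Even (i : ℕ) then .d else .f, fun i => if Even (i : ℕ) then .a else .c,
    ?_, ?_, inVD_alternating hm rfl rfl rfl rfl, inVD_alternating hm rfl rfl rfl rfl,
    fun i => ?_⟩
  · funext i
    simp only [outlet]
    split_ifs <;> rfl
  · funext i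
    simp only [outlet]
    split_ifs <;> rfl
  · dsimp only
    split_ifs <;> rfl

/-- For `m ≥ 2`, the all-true word `1^m` and the all-false word `0^m` are mutually
reachable in the transfer digraph `D*_m` iff `m` is even. -/
theorem allTrue_allFalse_mutually_reachable_iff (m : ℕ) (hm : 2 ≤ m) :
    (Relation.ReflTransGen DStarArc (fun _ : Fin m => true) (fun _ : Fin m => false) ∧
     Relation.ReflTransGen DStarArc (fun _ : Fin m => false) (fun _ : Fin m => true)) ↔
    Even m := by
  constructor
  · rintro ⟨h, -⟩
    by_contra hodd
    have := altSum_eq_one_of_reachable (Nat.not_even_iff_odd.mp hodd) h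
    simp [altSum] at this
  · exact fun h => ⟨.single (dStarArc_allTrue_allFalse h), .single (dStarArc_allFalse_allTrue h)⟩
end
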